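/- Let Σ be the infinite sector {(r,θ): r>0, 0<θ<θ₀} with θ₀ ∈ (0,π) and let q be a polynomial in two variables satisfying the biharmonic equation Δ²q = 0 in Σ together with q = 0 and ∂_ν q = 0 on both boundary rays ∂Σ (i.e., on θ = 0 and θ = θ₀). Then q ≡ 0 in Σ. -/

import Mathlib

open Set

/-- First coordinate partial derivative. -/
noncomputable def pdx (f : ℝ × ℝ → ℂ) (p : ℝ × ℝ) : ℂ := deriv (fun t => f (t, p.2)) p.1
/-- Second coordinate partial derivative. -/
noncomputable def pdy (f : ℝ × ℝ → ℂ) (p : ℝ × ℝ) : ℂ := deriv (fun t => f (p.1, t)) p.2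
/-- The Laplacian `Δf = ∂²f/∂x₁² + ∂²f/∂x₂²`. -/
noncomputable def lap (f : ℝ × ℝ → ℂ) (p : ℝ × ℝ) : ℂ := pdx (pdx f) p + pdy (pdy f) p

/-- The infinite sector `{(r,θ) : r > 0, 0 < θ < θ₀}`. -/
def Sector (θ₀ : ℝ) : Set (ℝ × ℝ) :=
  {p | ∃ r θ : ℝ, 0 < r ∧ 0 < θ ∧ θ < θ₀ ∧ p = (r * Real.cos θ, r * Real.sin θ)}


open MvPolynomial in
theorem hasDeriv_aux (Q : MvPolynomial (Fin 2) ℂ) (a b : ℝ → ℂ) (a' b' : ℂ) (s : ℝ)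
    (ha : HasDerivAt a a' s) (hb : HasDerivAt b b' s) :
    HasDerivAt (fun t => eval ![a t, b t] Q)
      (a' * eval ![a s, b s] (pderiv 0 Q) + b' * eval ![a s, b s] (pderiv 1 Q)) s := by
  induction Q using MvPolynomial.induction_on with
  | C c => simpa using hasDerivAt_const s c
  | add p q hp hq =>
    simp only [map_add]
    refine (hp.fun_add hq).congr_deriv ?_
    ring
  | mul_X p i hp =>
    fin_cases i
    · have := hp.fun_mul ha
      simp [Derivation.leibniz, pderiv_X] at this ⊢
      refine this.congr_deriv ?_
      ring
    · have := hp.fun_mul hb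
      simp [Derivation.leibniz, pderiv_X] at this ⊢
      refine this.congr_deriv ?_
      ring

open MvPolynomial in
noncomputable def FQ (Q : MvPolynomial (Fin 2) ℂ) (p : ℝ × ℝ) : ℂ :=
  eval ![(p.1 : ℂ) + p.2 * Complex.I, (p.1 : ℂ) - p.2 * Complex.I] Q

theorem FQ_diff (Q : MvPolynomial (Fin 2) ℂ) : Differentiable ℝ (FQ Q) := by
  have h1 : Differentiable ℝ (fun p : ℝ × ℝ => (p.1 : ℂ)) :=
    Complex.ofRealCLM.differentiable.comp differentiable_fst
  have h2 : Differentiable ℝ (fun p : ℝ × ℝ => (p.2 : ℂ)) :=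
    Complex.ofRealCLM.differentiable.comp differentiable_snd
  unfold FQ
  induction Q using MvPolynomial.induction_on with
  | C c => simp
  | add p q hp hq => simpa using hp.fun_add hq
  | mul_X p i hp =>
    fin_cases i
    · simpa using hp.fun_mul (h1.fun_add (h2.mul_const Complex.I))
    · simpa using hp.fun_mul (h1.fun_sub (h2.mul_const Complex.I))

open MvPolynomial in
theorem FQ_fderiv (Q : MvPolynomial (Fin 2) ℂ) (p v : ℝ × ℝ) :
    fderiv ℝ (FQ Q) p v = ((v.1 : ℂ) + v.2 * Complex.I) * FQ (pderiv 0 Q) p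
      + ((v.1 : ℂ) - v.2 * Complex.I) * FQ (pderiv 1 Q) p := by
  have hl : HasDerivAt (fun s : ℝ => p + s • v) v 0 := by
    simpa using ((hasDerivAt_id (0:ℝ)).smul_const v).const_add p
  have h1 : HasDerivAt (fun s : ℝ => FQ Q (p + s • v)) (fderiv ℝ (FQ Q) p v) 0 := by
    have := (FQ_diff Q (p + (0:ℝ) • v)).hasFDerivAt.comp_hasDerivAt (0:ℝ) hl
    simpa [Function.comp_def] using this
  have hx : HasDerivAt (fun s : ℝ => (((p + s • v).1 : ℝ) : ℂ)) (v.1 : ℂ) 0 := by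
    have : HasDerivAt (fun s : ℝ => p.1 + s * v.1) v.1 0 := by
      simpa using ((hasDerivAt_id (0:ℝ)).mul_const v.1).const_add p.1
    simpa using this.ofReal_comp
  have hy : HasDerivAt (fun s : ℝ => (((p + s • v).2 : ℝ) : ℂ)) (v.2 : ℂ) 0 := by
    have : HasDerivAt (fun s : ℝ => p.2 + s * v.2) v.2 0 := by
      simpa using ((hasDerivAt_id (0:ℝ)).mul_const v.2).const_add p.2
    simpa using this.ofReal_comp
  have h2 := hasDeriv_aux Q _ _ _ _ 0 (hx.fun_add (hy.mul_const Complex.I))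
    (hx.fun_sub (hy.mul_const Complex.I))
  have h3 := h1.unique h2
  rw [h3]
  simp [FQ]

open MvPolynomial in
theorem pdx_FQ (Q : MvPolynomial (Fin 2) ℂ) : pdx (FQ Q) = FQ (pderiv 0 Q + pderiv 1 Q) := by
  funext p
  have hx : HasDerivAt (fun s : ℝ => (s : ℂ)) 1 p.1 := by
    simpa using (hasDerivAt_id p.1).ofReal_comp
  have := (hasDeriv_aux Q _ _ _ _ p.1 (hx.add_const (p.2 * Complex.I))
    (hx.sub_const (p.2 * Complex.I))).deriv
  unfold pdx FQ
  simpa using this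

open MvPolynomial in
theorem pdy_FQ (Q : MvPolynomial (Fin 2) ℂ) :
    pdy (FQ Q) = FQ (C Complex.I * (pderiv 0 Q - pderiv 1 Q)) := by
  funext p
  have hx : HasDerivAt (fun s : ℝ => (s : ℂ) * Complex.I) Complex.I p.2 := by
    simpa using (hasDerivAt_id p.2).ofReal_comp.mul_const Complex.I
  have := (hasDeriv_aux Q _ _ _ _ p.2 (hx.const_add (p.1 : ℂ)) (hx.const_sub (p.1 : ℂ))).deriv
  unfold pdy FQ
  simp at this ⊢
  rw [this]
  ring

open MvPolynomial in
theorem lap_FQ (Q : MvPolynomial (Fin 2) ℂ) :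
    lap (FQ Q) = FQ (2 * (pderiv 0 (pderiv 1 Q) + pderiv 1 (pderiv 0 Q))) := by
  funext p
  unfold lap
  rw [pdx_FQ, pdx_FQ, pdy_FQ, pdy_FQ]
  simp only [FQ, map_add, map_sub, pderiv_C_mul, map_mul, eval_C, map_ofNat]
  ring_nf
  simp only [Complex.I_sq]
  ring

/-- coefficient at `z^j w^k` -/
noncomputable def cf (Q : MvPolynomial (Fin 2) ℂ) (j k : ℕ) : ℂ :=
  MvPolynomial.coeff (Finsupp.single 0 j + Finsupp.single 1 k) Q

open MvPolynomial in
theorem single_eq_iff (d : Fin 2 →₀ ℕ) (j k : ℕ) :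
    d = Finsupp.single 0 j + Finsupp.single 1 k ↔ d 0 = j ∧ d 1 = k := by
  constructor
  · rintro rfl; simp
  · rintro ⟨rfl, rfl⟩
    ext i; fin_cases i <;> simp

open MvPolynomial in
theorem cf_monomial (d : Fin 2 →₀ ℕ) (c : ℂ) (j k : ℕ) :
    cf (monomial d c) j k = if d 0 = j ∧ d 1 = k then c else 0 := by
  unfold cf
  rw [coeff_monomial]
  simp only [single_eq_iff]

theorem cf_add (P Q : MvPolynomial (Fin 2) ℂ) (j k : ℕ) : cf (P + Q) j k = cf P j k + cf Q j k := by
  simp [cf]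

open MvPolynomial in
theorem cf_pderiv0 (Q : MvPolynomial (Fin 2) ℂ) (j k : ℕ) :
    cf (pderiv 0 Q) j k = (j + 1) * cf Q (j + 1) k := by
  unfold cf
  rw [coeff_pderiv, mul_comm]
  congr 2
  · simp
  · rw [single_eq_iff]; simp

open MvPolynomial in
theorem cf_pderiv1 (Q : MvPolynomial (Fin 2) ℂ) (j k : ℕ) :
    cf (pderiv 1 Q) j k = (k + 1) * cf Q j (k + 1) := by
  unfold cf
  rw [coeff_pderiv, mul_comm]
  congr 2
  · simp
  · rw [single_eq_iff]; simp

open MvPolynomial in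
theorem cf_euler (Q : MvPolynomial (Fin 2) ℂ) (j k : ℕ) :
    cf (X 0 * pderiv 0 Q - X 1 * pderiv 1 Q) j k = ((j : ℂ) - k) * cf Q j k := by
  have h0 : cf (X 0 * pderiv 0 Q) j k = j * cf Q j k := by
    induction Q using MvPolynomial.induction_on' with
    | add p q hp hq => simp only [map_add, mul_add, cf_add, hp, hq]
    | monomial d c =>
      rw [X_mul_pderiv_monomial, cf_monomial, ← Nat.cast_smul_eq_nsmul ℂ, smul_monomial, cf_monomial]
      aesop
  have h1 : cf (X 1 * pderiv 1 Q) j k = k * cf Q j k := by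
    clear h0
    induction Q using MvPolynomial.induction_on' with
    | add p q hp hq => simp only [map_add, mul_add, cf_add, hp, hq]
    | monomial d c =>
      rw [X_mul_pderiv_monomial, cf_monomial, ← Nat.cast_smul_eq_nsmul ℂ, smul_monomial, cf_monomial]
      aesop
  have : cf (X 0 * pderiv 0 Q - X 1 * pderiv 1 Q) j k
    = cf (X 0 * pderiv 0 Q) j k - cf (X 1 * pderiv 1 Q) j k := by simp [cf]
  rw [this, h0, h1]; ring

open MvPolynomial in
theorem homog (R : MvPolynomial (Fin 2) ℂ) (u v : ℂ)
    (h : ∀ t : ℝ, 0 < t → eval ![t * u, t * v] R = 0) (n : ℕ) :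
    ∑ x ∈ Finset.HasAntidiagonal.antidiagonal n, cf R x.1 x.2 * (u ^ x.1 * v ^ x.2) = 0 := by
  let G : MvPolynomial (Fin 2) ℂ → Polynomial ℂ := fun R =>
    aeval ![Polynomial.X * Polynomial.C u, Polynomial.X * Polynomial.C v] R
  have hc : ∀ R, (G R).coeff n = ∑ x ∈ Finset.HasAntidiagonal.antidiagonal n, cf R x.1 x.2 * (u ^ x.1 * v ^ x.2) := by
    intro R
    induction R using MvPolynomial.induction_on' with
    | add p q hp hq =>
      simp only [cf_add, add_mul, Finset.sum_add_distrib, ← hp, ← hq]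
      simp [G]
    | monomial d c =>
      simp only [G, aeval_monomial, cf_monomial]
      rw [Finsupp.prod_fintype _ _ (by simp)]
      simp only [Fin.prod_univ_two, Matrix.cons_val_zero, Matrix.cons_val_one, mul_pow]
      have e : (algebraMap ℂ (Polynomial ℂ)) c * (Polynomial.X ^ d 0 * Polynomial.C u ^ d 0 *
          (Polynomial.X ^ d 1 * Polynomial.C v ^ d 1))
          = Polynomial.C (c * (u ^ d 0 * v ^ d 1)) * Polynomial.X ^ (d 0 + d 1) := by
        simp [Polynomial.algebraMap_eq]; ring
      rw [e, Polynomial.coeff_C_mul_X_pow]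
      by_cases hn : n = d 0 + d 1
      · rw [if_pos hn, Finset.sum_eq_single_of_mem (d 0, d 1) (by simp [hn])]
        · simp
        · rintro ⟨a, b⟩ _ hab
          have : ¬ (d 0 = a ∧ d 1 = b) := by rintro ⟨rfl, rfl⟩; exact hab rfl
          simp [this]
      · rw [if_neg hn, Finset.sum_eq_zero]
        rintro ⟨a, b⟩ hab
        have : ¬ (d 0 = a ∧ d 1 = b) := by
          rintro ⟨rfl, rfl⟩; simp at hab; exact hn hab.symm
        simp [this]
  have he : ∀ (t : ℂ) R, (G R).eval t = eval ![t * u, t * v] R := by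
    intro t R
    induction R using MvPolynomial.induction_on with
    | C c => simp [G]
    | add p q hp hq => simp [G] at hp hq ⊢; rw [hp, hq]
    | mul_X p i hp =>
      simp [G] at hp ⊢
      rw [hp]
      fin_cases i <;> simp <;> left <;> ring
  have hz : G R = 0 := by
    apply Polynomial.eq_zero_of_infinite_isRoot
    apply Set.Infinite.mono (s := (fun t : ℝ => (t : ℂ)) '' Set.Ioi 0)
    · rintro _ ⟨t, ht, rfl⟩
      simp only [Set.mem_ofPred_eq, Polynomial.IsRoot, he]
      exact h t ht
    · exact (Set.Ioi_infinite 0).image (Complex.ofReal_injective.injOn)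
  rw [← hc, hz]; simp

open MvPolynomial in
theorem FQ_polar (Q : MvPolynomial (Fin 2) ℂ) (r θ : ℝ) :
    FQ Q (r * Real.cos θ, r * Real.sin θ) =
      eval ![(r : ℂ) * Complex.exp (θ * Complex.I), (r : ℂ) * Complex.exp (-(θ * Complex.I))] Q := by
  unfold FQ
  have h1 : Complex.exp (θ * Complex.I) = Complex.cos θ + Complex.sin θ * Complex.I :=
    Complex.exp_mul_I _
  have h2 : Complex.exp (-(θ * Complex.I)) = Complex.cos θ - Complex.sin θ * Complex.I := by
    rw [← neg_mul, Complex.exp_mul_I, Complex.cos_neg, Complex.sin_neg]; ring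
  rw [h1, h2]
  push_cast
  congr 2
  ring_nf

theorem zero_of_sector (θ₀ : ℝ) (hθ : θ₀ ∈ Set.Ioo 0 Real.pi) (R : MvPolynomial (Fin 2) ℂ)
    (h : ∀ p ∈ Sector θ₀, FQ R p = 0) (j k : ℕ) : cf R j k = 0 := by
  have hs : ∀ θ ∈ Set.Ioo 0 θ₀, ∑ x ∈ Finset.HasAntidiagonal.antidiagonal (j + k), cf R x.1 x.2 *
      (Complex.exp (θ * Complex.I) ^ x.1 * Complex.exp (-(θ * Complex.I)) ^ x.2) = 0 := by
    intro θ hθ'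
    apply homog
    intro t ht
    rw [← FQ_polar]
    exact h _ ⟨t, θ, ht, hθ'.1, hθ'.2, rfl⟩
  let G : Polynomial ℂ := ∑ x ∈ Finset.HasAntidiagonal.antidiagonal (j + k),
    Polynomial.C (cf R x.1 x.2) * Polynomial.X ^ x.1
  have hG : G = 0 := by
    apply Polynomial.eq_zero_of_infinite_isRoot
    apply Set.Infinite.mono (s := (fun t : ℝ => Complex.exp (2 * t * Complex.I)) '' Set.Ioo 0 θ₀)
    · rintro _ ⟨t, ht, rfl⟩
      have := hs t ht
      simp only [Set.mem_ofPred_eq, Polynomial.IsRoot, G, Polynomial.eval_finsetSum,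
        Polynomial.eval_mul, Polynomial.eval_C, Polynomial.eval_pow, Polynomial.eval_X]
      rw [← mul_zero (Complex.exp (t * Complex.I) ^ (j + k)), ← this, Finset.mul_sum]
      apply Finset.sum_congr rfl
      rintro ⟨a, b⟩ hab
      have hab' : a + b = j + k := by simpa using hab
      have e1 : Complex.exp (2 * t * Complex.I) = Complex.exp (t * Complex.I) ^ 2 := by
        rw [← Complex.exp_nat_mul]; congr 1; push_cast; ring
      have e2 : Complex.exp (t * Complex.I) * Complex.exp (-(t * Complex.I)) = 1 := by
        rw [← Complex.exp_add]; simp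
      have e3 : Complex.exp (t * Complex.I) ^ b * Complex.exp (-(t * Complex.I)) ^ b = 1 := by
        rw [← mul_pow, e2, one_pow]
      simp only
      rw [← hab', e1]
      linear_combination (-cf R a b * Complex.exp (t * Complex.I) ^ (2 * a)) * e3
    · apply Set.Infinite.image
      · intro a ha b hb hab
        simp only at hab
        have hab2 := congrArg Complex.re hab
        have ea : ∀ x : ℝ, (2 * (x : ℂ) * Complex.I) = ((2 * x : ℝ) : ℂ) * Complex.I := by
          intro x; push_cast; ring
        rw [ea, ea, Complex.exp_eq_exp_iff_exists_int] at hab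
        obtain ⟨n, hn⟩ := hab
        have hn2 := congrArg Complex.im hn
        simp at hn2
        have hpi := Real.pi_pos
        obtain ⟨h1, h2⟩ := ha
        obtain ⟨h3, h4⟩ := hb
        obtain ⟨h5, h6⟩ := hθ
        have hn0 : n = 0 := by
          have l1 : (n : ℝ) < 1 := by nlinarith
          have l2 : (-1 : ℝ) < n := by nlinarith
          have l1' : n < 1 := by exact_mod_cast l1
          have l2' : -1 < n := by exact_mod_cast l2
          omega
        rw [hn0] at hn2
        simp at hn2
        linarith
      · exact Set.Ioo_infinite hθ.1
  have hc : G.coeff j = cf R j k := by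
    simp only [G, Polynomial.finsetSum_coeff, Polynomial.coeff_C_mul_X_pow]
    rw [Finset.sum_eq_single_of_mem (j, k) (by simp)]
    · simp
    · rintro ⟨a, b⟩ hab hne
      rw [if_neg]
      rintro rfl
      apply hne
      have : j + b = j + k := by simpa using hab
      simp at this
      rw [this]
  rw [← hc, hG]; simp

theorem sin_lt (θ : ℝ) (hθ : θ ∈ Set.Ioo 0 Real.pi) (m : ℕ) :
    |Real.sin ((m + 2 : ℕ) * θ)| < (m + 2 : ℕ) * Real.sin θ := by
  have hs : 0 < Real.sin θ := Real.sin_pos_of_mem_Ioo hθ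
  have hc : |Real.cos θ| < 1 := by
    have := Real.sin_sq_add_cos_sq θ
    rw [← sq_lt_one_iff_abs_lt_one]
    nlinarith
  have step : ∀ k : ℕ, 1 ≤ k → |Real.sin (k * θ)| ≤ k * Real.sin θ →
      |Real.sin ((k + 1 : ℕ) * θ)| < (k + 1 : ℕ) * Real.sin θ := by
    intro k hk hle
    have hk' : (1 : ℝ) ≤ k := by exact_mod_cast hk
    have e : Real.sin ((k + 1 : ℕ) * θ)
        = Real.sin (k * θ) * Real.cos θ + Real.cos (k * θ) * Real.sin θ := by
      rw [← Real.sin_add]; congr 1; push_cast; ring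
    have a1 := abs_add_le (Real.sin (k * θ) * Real.cos θ) (Real.cos (k * θ) * Real.sin θ)
    rw [abs_mul, abs_mul, abs_of_pos hs] at a1
    have a2 := Real.abs_cos_le_one (k * θ)
    have a3 : |Real.sin (k * θ)| * |Real.cos θ| ≤ k * Real.sin θ * |Real.cos θ| := by gcongr
    have a4 : k * Real.sin θ * |Real.cos θ| < k * Real.sin θ * 1 := by
      apply mul_lt_mul_of_pos_left hc; positivity
    have a5 : |Real.cos (k * θ)| * Real.sin θ ≤ 1 * Real.sin θ := by gcongr
    rw [e]; push_cast; linarith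
  induction m with
  | zero => exact step 1 le_rfl (by simp [abs_of_pos hs])
  | succ m ih => exact step (m + 2) (by omega) ih.le

theorem sum_four (f : ℕ → ℕ → ℂ) (l : ℕ) (hf : ∀ j k, f (j + 2) (k + 2) = 0) :
    ∑ x ∈ Finset.HasAntidiagonal.antidiagonal (l + 3), f x.1 x.2
      = f 0 (l + 3) + f (l + 3) 0 + f 1 (l + 2) + f (l + 2) 1 := by
  rw [Finset.Nat.sum_antidiagonal_succ, Finset.Nat.sum_antidiagonal_succ',
    Finset.Nat.sum_antidiagonal_succ, Finset.sum_eq_single_of_mem (l, 0) (by simp)]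
  · simp only [zero_add]; ring
  · rintro ⟨a, b⟩ hab hne
    have hab' : a + b = l := by simpa using hab
    rcases b with _ | b
    · exfalso; apply hne; simp at hab'; simp [hab']
    · exact hf a b

/-- The linear algebra for one homogeneous degree. -/
theorem lin_alg (u v A B C D : ℂ) (m : ℕ) (huv : u * v = 1)
    (hdet : (m : ℂ) ^ 2 * (u - v) ^ 2 - (u ^ m - v ^ m) ^ 2 ≠ 0) (hm : 2 ≤ m)
    (h1 : D + A + C + B = 0)
    (h2 : -((m : ℂ) + 1) * D + (m + 1) * A - (m - 1) * C + (m - 1) * B = 0)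
    (h3 : D * v ^ (m + 1) + A * u ^ (m + 1) + C * (u * v ^ m) + B * (u ^ m * v) = 0)
    (h4 : -((m : ℂ) + 1) * (D * v ^ (m + 1)) + (m + 1) * (A * u ^ (m + 1))
      - (m - 1) * (C * (u * v ^ m)) + (m - 1) * (B * (u ^ m * v)) = 0) :
    A = 0 ∧ B = 0 ∧ C = 0 ∧ D = 0 := by
  have hA : A = (m - 1) * C + m * D := by linear_combination h2 / 2 - (m - 1) / 2 * h1
  have hB : B = -(m * C) - (m + 1) * D := by linear_combination h1 - hA
  have hA' : A * u ^ (m + 1) = (m - 1) * (C * (u * v ^ m)) + m * (D * v ^ (m + 1)) := by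
    linear_combination h4 / 2 - (m - 1) / 2 * h3
  have hB' : B * (u ^ m * v) = -(m * (C * (u * v ^ m))) - (m + 1) * (D * v ^ (m + 1)) := by
    linear_combination h3 - hA'
  have hU : u ^ m * v ^ m = 1 := by rw [← mul_pow, huv, one_pow]
  rw [hA] at hA'
  rw [hB] at hB'
  rw [pow_succ, pow_succ] at hA'
  rw [pow_succ] at hB'
  generalize hx : u ^ m = x at *
  generalize hy : v ^ m = y at *
  have hv : v ≠ 0 := right_ne_zero_of_mul_eq_one huv
  -- two equations in C and D
  have E1 : (m - 1) * C * (x - y) + m * D * (x - y * v ^ 2) = 0 := by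
    linear_combination v * hA' + (-((m - 1) * C + m * D) * x + (m - 1) * C * y) * huv
  have E2 : m * C * (x - y * u ^ 2) + (m + 1) * D * (x - y) = 0 := by
    linear_combination -u * hB' + (-(m * C + (m + 1) * D) * x + (m + 1) * D * y) * huv
  have key : (m : ℂ) ^ 2 * (u - v) ^ 2 - (x - y) ^ 2 =
      (m - 1) * (x - y) * ((m + 1) * (x - y)) - m * (x - y * v ^ 2) * (m * (x - y * u ^ 2)) := by
    linear_combination (-(m : ℂ) ^ 2 * (u ^ 2 + v ^ 2 - 2)) * hU
      + (m : ℂ) ^ 2 * (-2 + y ^ 2 * (u * v + 1)) * huv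
  have hC : C = 0 := by
    have : ((m : ℂ) ^ 2 * (u - v) ^ 2 - (x - y) ^ 2) * C = 0 := by
      rw [key]
      linear_combination (m + 1) * (x - y) * E1 - m * (x - y * v ^ 2) * E2
    exact (mul_eq_zero.mp this).resolve_left hdet
  have hD : D = 0 := by
    have : ((m : ℂ) ^ 2 * (u - v) ^ 2 - (x - y) ^ 2) * D = 0 := by
      rw [key]
      linear_combination (m - 1) * (x - y) * E2 - m * (x - y * u ^ 2) * E1
    exact (mul_eq_zero.mp this).resolve_left hdet
  refine ⟨?_, ?_, hC, hD⟩
  · rw [hA, hC, hD]; ring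
  · rw [hB, hC, hD]; ring

/-- A biharmonic polynomial with vanishing Cauchy data on the two rays bounding a
sector of opening angle `θ₀ ∈ (0,π)` vanishes identically on the sector. -/
theorem stmt9 (θ₀ : ℝ) (hθ : θ₀ ∈ Set.Ioo 0 Real.pi) (q : ℝ × ℝ → ℂ)
    (hpoly : ∃ P : MvPolynomial (Fin 2) ℂ,
      ∀ p : ℝ × ℝ, q p = MvPolynomial.eval (fun i : Fin 2 => if i = 0 then ((p.1 : ℂ)) else ((p.2 : ℂ))) P)
    (hbih : ∀ p ∈ Sector θ₀, lap (lap q) p = 0)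
    (hray1 : ∀ t : ℝ, 0 < t → q (t, 0) = 0 ∧ fderiv ℝ q (t, 0) (0, 1) = 0)
    (hray2 : ∀ t : ℝ, 0 < t →
      q (t * Real.cos θ₀, t * Real.sin θ₀) = 0 ∧
      fderiv ℝ q (t * Real.cos θ₀, t * Real.sin θ₀) (-Real.sin θ₀, Real.cos θ₀) = 0) :
    ∀ p ∈ Sector θ₀, q p = 0 := by
  classical
  obtain ⟨P, hP⟩ := hpoly
  -- pass to the variables `z`, `conj z`
  obtain ⟨Q, hQ⟩ : ∃ Q : MvPolynomial (Fin 2) ℂ, q = FQ Q := by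
    refine ⟨MvPolynomial.bind₁ ![MvPolynomial.C (1 / 2) * (MvPolynomial.X 0 + MvPolynomial.X 1),
      MvPolynomial.C (-Complex.I / 2) * (MvPolynomial.X 0 - MvPolynomial.X 1)] P, ?_⟩
    funext p
    rw [hP, FQ, MvPolynomial.eval, MvPolynomial.eval, MvPolynomial.eval₂Hom_bind₁]
    congr 2
    funext i
    fin_cases i
    · simp
      ring
    · simp
      ring_nf
      simp
  subst hQ
  have hz : ∀ j k, cf Q (j + 2) (k + 2) = 0 := by
    intro j k
    rw [lap_FQ, lap_FQ] at hbih
    have h0 := zero_of_sector θ₀ hθ _ hbih j k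
    have h2 : ∀ (R : MvPolynomial (Fin 2) ℂ) (j k : ℕ), cf (2 * R) j k = 2 * cf R j k := by
      intro R j k
      rw [two_mul, cf_add, two_mul]
    have hlap : ∀ (R : MvPolynomial (Fin 2) ℂ) (j k : ℕ),
        cf (2 * (MvPolynomial.pderiv 0 (MvPolynomial.pderiv 1 R)
          + MvPolynomial.pderiv 1 (MvPolynomial.pderiv 0 R))) j k
        = 4 * (j + 1) * (k + 1) * cf R (j + 1) (k + 1) := by
      intro R j k
      rw [h2, cf_add, cf_pderiv0, cf_pderiv1, cf_pderiv1, cf_pderiv0]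
      ring
    rw [hlap, hlap] at h0
    have c1 : (4 * ((j : ℂ) + 1) * (k + 1)) ≠ 0 := by
      have a1 : (j : ℂ) + 1 ≠ 0 := by exact_mod_cast Nat.succ_ne_zero j
      have a2 : (k : ℂ) + 1 ≠ 0 := by exact_mod_cast Nat.succ_ne_zero k
      exact mul_ne_zero (mul_ne_zero (by norm_num) a1) a2
    have c2 : (4 * (((j + 1 : ℕ) : ℂ) + 1) * ((k + 1 : ℕ) + 1)) ≠ 0 := by
      have a1 : ((j + 1 : ℕ) : ℂ) + 1 ≠ 0 := by exact_mod_cast Nat.succ_ne_zero (j + 1)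
      have a2 : ((k + 1 : ℕ) : ℂ) + 1 ≠ 0 := by exact_mod_cast Nat.succ_ne_zero (k + 1)
      exact mul_ne_zero (mul_ne_zero (by norm_num) a1) a2
    exact (mul_eq_zero.mp ((mul_eq_zero.mp h0).resolve_left c1)).resolve_left c2
  -- Cauchy data on a ray
  have hray : ∀ θ : ℝ, (∀ t : ℝ, 0 < t →
      FQ Q (t * Real.cos θ, t * Real.sin θ) = 0 ∧
      fderiv ℝ (FQ Q) (t * Real.cos θ, t * Real.sin θ) (-Real.sin θ, Real.cos θ) = 0) →
      ∀ n : ℕ, (∑ x ∈ Finset.HasAntidiagonal.antidiagonal n, cf Q x.1 x.2 *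
        (Complex.exp (θ * Complex.I) ^ x.1 * Complex.exp (-(θ * Complex.I)) ^ x.2) = 0) ∧
      (∑ x ∈ Finset.HasAntidiagonal.antidiagonal n, ((x.1 : ℂ) - x.2) * cf Q x.1 x.2 *
        (Complex.exp (θ * Complex.I) ^ x.1 * Complex.exp (-(θ * Complex.I)) ^ x.2) = 0) := by
    intro θ h n
    constructor
    · apply homog
      intro t ht
      rw [← FQ_polar]
      exact (h t ht).1
    · simp only [← cf_euler]
      apply homog
      intro t ht
      rw [← FQ_polar]
      have h2 := (h t ht).2
      rw [FQ_fderiv] at h2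
      simp only [FQ, map_sub, map_mul, MvPolynomial.eval_X] at h2 ⊢
      generalize MvPolynomial.eval _ (MvPolynomial.pderiv 0 Q) = a at *
      generalize MvPolynomial.eval _ (MvPolynomial.pderiv 1 Q) = b at *
      simp at h2 ⊢
      linear_combination (-Complex.I * t) * h2 + t * (Complex.cos θ * (a - b)
        + 0) * Complex.I_sq
  have r1 := hray 0 (by simpa using hray1)
  have r2 := hray θ₀ hray2
  simp only [Complex.ofReal_zero, zero_mul, neg_zero, Complex.exp_zero, one_pow, mul_one] at r1
  have huv : Complex.exp (θ₀ * Complex.I) * Complex.exp (-(θ₀ * Complex.I)) = 1 := by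
    rw [← Complex.exp_add]; simp
  have hpw : ∀ m : ℕ, Complex.exp (θ₀ * Complex.I) ^ m - Complex.exp (-(θ₀ * Complex.I)) ^ m
      = 2 * Complex.I * (Real.sin (m * θ₀) : ℝ) := by
    intro m
    have e1 : Complex.exp (θ₀ * Complex.I) ^ m = Complex.exp ((m * θ₀ : ℂ) * Complex.I) := by
      rw [← Complex.exp_nat_mul]; congr 1; ring
    have e2 : Complex.exp (-(θ₀ * Complex.I)) ^ m = Complex.exp ((-(m * θ₀) : ℂ) * Complex.I) := by
      rw [← Complex.exp_nat_mul]; congr 1; ring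
    rw [e1, e2, Complex.exp_mul_I, Complex.exp_mul_I, Complex.cos_neg, Complex.sin_neg]
    push_cast
    ring
  generalize Complex.exp (θ₀ * Complex.I) = u at *
  generalize Complex.exp (-(θ₀ * Complex.I)) = v at *
  have hs : 0 < Real.sin θ₀ := Real.sin_pos_of_mem_Ioo hθ
  have huv1 : u - v = 2 * Complex.I * (Real.sin θ₀ : ℝ) := by simpa using hpw 1
  have hne : u - v ≠ 0 := by
    rw [huv1]
    have : ((Real.sin θ₀ : ℝ) : ℂ) ≠ 0 := by exact_mod_cast hs.ne'
    simp only [ne_eq, mul_eq_zero, not_or]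
    exact ⟨⟨two_ne_zero, Complex.I_ne_zero⟩, this⟩
  have hall : ∀ n j k, j + k = n → cf Q j k = 0 := by
    intro n
    have a1 := (r1 n).1
    have a2 := (r1 n).2
    have a3 := (r2 n).1
    have a4 := (r2 n).2
    rcases n with _ | _ | _ | l
    · intro j k hjk
      obtain ⟨rfl, rfl⟩ : j = 0 ∧ k = 0 := by omega
      simpa using a1
    · simp [Finset.Nat.antidiagonal_succ] at a1 a2
      have e1 : cf Q 0 1 = 0 := by linear_combination a1 / 2 - a2 / 2
      have e2 : cf Q 1 0 = 0 := by linear_combination a1 / 2 + a2 / 2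
      intro j k hjk
      have : (j = 0 ∧ k = 1) ∨ (j = 1 ∧ k = 0) := by omega
      rcases this with ⟨rfl, rfl⟩ | ⟨rfl, rfl⟩ <;> assumption
    · simp [Finset.Nat.antidiagonal_succ] at a1 a2 a3
      have e1 : cf Q 2 0 = cf Q 0 2 := by linear_combination a2 / 2
      have e2 : cf Q 1 1 = -2 * cf Q 0 2 := by linear_combination a1 - e1
      have e3 : (u - v) ^ 2 * cf Q 0 2 = 0 := by
        rw [e1, e2] at a3
        linear_combination a3
      have e4 : cf Q 0 2 = 0 := (mul_eq_zero.mp e3).resolve_left (pow_ne_zero 2 hne)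
      rw [e4] at e1 e2
      simp at e2
      intro j k hjk
      have : (j = 0 ∧ k = 2) ∨ (j = 1 ∧ k = 1) ∨ (j = 2 ∧ k = 0) := by omega
      rcases this with ⟨rfl, rfl⟩ | ⟨rfl, rfl⟩ | ⟨rfl, rfl⟩ <;> assumption
    · rw [sum_four (fun j k => cf Q j k) l (by simp [hz])] at a1
      rw [sum_four (fun j k => ((j : ℂ) - k) * cf Q j k) l (by simp [hz])] at a2
      rw [sum_four (fun j k => cf Q j k * (u ^ j * v ^ k)) l (by simp [hz])] at a3
      rw [sum_four (fun j k => ((j : ℂ) - k) * cf Q j k * (u ^ j * v ^ k)) l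
        (by simp [hz])] at a4
      have hdet : ((l + 2 : ℕ) : ℂ) ^ 2 * (u - v) ^ 2 - (u ^ (l + 2) - v ^ (l + 2)) ^ 2 ≠ 0 := by
        rw [hpw, huv1]
        have hlt := sin_lt θ₀ hθ l
        have hsq : Real.sin ((l + 2 : ℕ) * θ₀) ^ 2 < ((l + 2 : ℕ) * Real.sin θ₀) ^ 2 := by
          apply sq_lt_sq'
          · linarith [(abs_lt.mp hlt).1]
          · exact (abs_lt.mp hlt).2
        intro h0
        have h1 : ((((l + 2 : ℕ) * Real.sin θ₀) ^ 2 - Real.sin ((l + 2 : ℕ) * θ₀) ^ 2 : ℝ) : ℂ)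
            = 0 := by
          rw [Complex.ofReal_sub, Complex.ofReal_pow, Complex.ofReal_pow, Complex.ofReal_mul,
            Complex.ofReal_natCast]
          linear_combination (-1 / 4) * h0 + ((((l + 2 : ℕ) : ℂ) * (Real.sin θ₀ : ℝ)) ^ 2
            - ((Real.sin ((l + 2 : ℕ) * θ₀) : ℝ) : ℂ) ^ 2) * Complex.I_sq
        have h2 := Complex.ofReal_eq_zero.mp h1
        linarith
      obtain ⟨hA, hB, hC, hD⟩ := lin_alg u v (cf Q (l + 3) 0) (cf Q (l + 2) 1) (cf Q 1 (l + 2))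
        (cf Q 0 (l + 3)) (l + 2) huv hdet (by omega)
        a1
        (by push_cast at a2 ⊢; linear_combination a2)
        (by linear_combination a3)
        (by push_cast at a4 ⊢; linear_combination a4)
      intro j k hjk
      rcases j with _ | _ | j
      · obtain rfl : k = l + 3 := by omega
        exact hD
      · obtain rfl : k = l + 2 := by omega
        exact hC
      · rcases k with _ | _ | k
        · obtain rfl : j = l + 1 := by omega
          exact hA
        · obtain rfl : j = l := by omega
          exact hB
        · exact hz j k
  have hQ0 : Q = 0 := by
    apply MvPolynomial.ext
    intro d
    have := hall _ (d 0) (d 1) rfl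
    unfold cf at this
    rw [← (single_eq_iff d _ _).mpr ⟨rfl, rfl⟩] at this
    simpa using this
  intro p _
  simp [FQ, hQ0]
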